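/- Let 𝔤 = 𝒜₄,₉^{−1/2} be the 4-dimensional real Lie algebra with brackets [e₂,e₃] = e₁, [e₁,e₄] = (1/2)e₁, [e₂,e₄] = e₂, [e₃,e₄] = −(1/2)e₃. Let a₁₃, a₂₄ ∈ ℝ satisfy a₁₃² − a₂₄² = 3/2. Then the Euclidean inner product g = e¹⊗e¹ + e²⊗e² + e³⊗e³ + e⁴⊗e⁴ together with the 2-form F = a₁₃ e¹∧e³ + a₂₄ e²∧e⁴ is a solution of the Einstein–Maxwell equations, and g is not Einstein. -/

import Mathlib

open scoped BigOperators

noncomputable section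

/-- The underlying vector space `ℝ⁴` of the 4-dimensional Lie algebra. -/
abbrev V4 : Type := Fin 4 → ℝ

/-- The standard basis `e₁, e₂, e₃, e₄` (0-indexed). -/
def ee (i : Fin 4) : V4 := Pi.single i 1

/-- `g` is an inner product: a positive-definite symmetric bilinear form. -/
structure IsInnerProduct (g : V4 → V4 → ℝ) : Prop where
  symm : ∀ x y, g x y = g y x
  add_left : ∀ x y z, g (x + y) z = g x z + g y z
  smul_left : ∀ (a : ℝ) (x y : V4), g (a • x) y = a * g x y
  pos : ∀ x : V4, x ≠ 0 → 0 < g x x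

/-- `F` is an alternating bilinear 2-form. -/
structure IsAltForm (F : V4 → V4 → ℝ) : Prop where
  skew : ∀ x y, F x y = - F y x
  add_left : ∀ x y z, F (x + y) z = F x z + F y z
  smul_left : ∀ (a : ℝ) (x y : V4), F (a • x) y = a * F x y

/-- Chevalley–Eilenberg differential of a 2-form with respect to the bracket `br`:
`dF(x,y,z) = −F([x,y],z) + F([x,z],y) − F([y,z],x)`. -/
def cdiff (br : V4 → V4 → V4) (F : V4 → V4 → ℝ) (x y z : V4) : ℝ :=
  - F (br x y) z + F (br x z) y - F (br y z) x

/-- A 2-form is closed if its Chevalley–Eilenberg differential vanishes. -/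
def IsClosedForm (br : V4 → V4 → V4) (F : V4 → V4 → ℝ) : Prop :=
  ∀ x y z, cdiff br F x y z = 0

/-- The Gram matrix of a bilinear form in the standard basis. -/
def gram (g : V4 → V4 → ℝ) : Matrix (Fin 4) (Fin 4) ℝ :=
  Matrix.of fun i j => g (ee i) (ee j)

/-- The inverse Gram matrix. -/
def ginv (g : V4 → V4 → ℝ) : Matrix (Fin 4) (Fin 4) ℝ := (gram g)⁻¹

/-- The inner product induced by `g` on 2-forms:
`⟨α,β⟩ = (1/2) Σ g^{ik} g^{jl} α_{ij} β_{kl}`. -/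
def formInner (g : V4 → V4 → ℝ) (α β : V4 → V4 → ℝ) : ℝ :=
  (1 / 2) * ∑ i, ∑ j, ∑ k, ∑ l,
    ginv g i k * ginv g j l * α (ee i) (ee j) * β (ee k) (ee l)

/-- The volume form of `g` for the orientation `e¹∧e²∧e³∧e⁴`. -/
def vol (g : V4 → V4 → ℝ) (x y z w : V4) : ℝ :=
  Real.sqrt (gram g).det * Matrix.det (Matrix.of fun i j => ![x, y, z, w] i j)

/-- The wedge product of two 2-forms, as a 4-form. -/
def wedge22 (α β : V4 → V4 → ℝ) (x y z w : V4) : ℝ :=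
  α x y * β z w - α x z * β y w + α x w * β y z
    + α z w * β x y - α y w * β x z + α y z * β x w

/-- `sF` is the Hodge star `⋆F` of `F` with respect to `g` and the orientation
`e¹∧e²∧e³∧e⁴`: it is the 2-form with `α ∧ sF = ⟨α,F⟩_g vol_g` for all 2-forms `α`. -/
def IsHodgeStar (g : V4 → V4 → ℝ) (F sF : V4 → V4 → ℝ) : Prop :=
  IsAltForm sF ∧
    ∀ α : V4 → V4 → ℝ, IsAltForm α → ∀ x y z w,
      wedge22 α sF x y z w = formInner g α F * vol g x y z w

/-- `F` is co-closed: `d(⋆F) = 0`. -/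
def IsCoclosed (br : V4 → V4 → V4) (g F : V4 → V4 → ℝ) : Prop :=
  ∃ sF, IsHodgeStar g F sF ∧ IsClosedForm br sF

/-- Koszul expression: `g(∇ₓy, z) = (1/2)(g([x,y],z) − g([y,z],x) + g([z,x],y))`. -/
def koszul (br : V4 → V4 → V4) (g : V4 → V4 → ℝ) (x y z : V4) : ℝ :=
  (1 / 2) * (g (br x y) z - g (br y z) x + g (br z x) y)

/-- The Levi-Civita product `∇ₓ y`, i.e. the unique vector with
`g(∇ₓy, z) = koszul x y z` for all `z` (computed via the inverse Gram matrix). -/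
def LC (br : V4 → V4 → V4) (g : V4 → V4 → ℝ) (x y : V4) : V4 :=
  fun m => ∑ k, koszul br g x y (ee k) * ginv g k m

/-- Curvature `R(x,y)z = ∇ₓ∇_y z − ∇_y∇ₓ z − ∇_{[x,y]} z`. -/
def curv (br : V4 → V4 → V4) (g : V4 → V4 → ℝ) (x y z : V4) : V4 :=
  LC br g x (LC br g y z) - LC br g y (LC br g x z) - LC br g (br x y) z

/-- Ricci tensor `Ric(x,y) = Σᵢ g(R(vᵢ,x)y, vᵢ)` for a `g`-orthonormal basis `(vᵢ)`,
i.e. the trace of the endomorphism `z ↦ R(z,x)y`. -/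
def ricci (br : V4 → V4 → V4) (g : V4 → V4 → ℝ) (x y : V4) : ℝ :=
  ∑ i, curv br g (ee i) x y i

/-- Scalar curvature: the `g`-trace of the Ricci tensor. -/
def scal (br : V4 → V4 → V4) (g : V4 → V4 → ℝ) : ℝ :=
  ∑ a, ∑ b, ginv g a b * ricci br g (ee a) (ee b)

/-- Trace-free Ricci tensor `Ric₀ = Ric − (s/4) g`. -/
def ricci0 (br : V4 → V4 → V4) (g : V4 → V4 → ℝ) (x y : V4) : ℝ :=
  ricci br g x y - (scal br g / 4) * g x y

/-- `g` is Einstein: `Ric₀ = 0`. -/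
def IsEinstein (br : V4 → V4 → V4) (g : V4 → V4 → ℝ) : Prop :=
  ∀ x y, ricci0 br g x y = 0

/-- The endomorphism `F̂` with `g(F̂x, y) = F(x,y)` (computed via the inverse Gram matrix). -/
def fhat (g F : V4 → V4 → ℝ) (x : V4) : V4 :=
  fun m => ∑ k, F x (ee k) * ginv g k m

/-- `[F∘F]₀(x,y) = g(F̂(F̂x), y) − (1/4) tr(F̂∘F̂) g(x,y)`. -/
def FF0 (g F : V4 → V4 → ℝ) (x y : V4) : ℝ :=
  g (fhat g F (fhat g F x)) y
    - (1 / 4) * (∑ i, fhat g F (fhat g F (ee i)) i) * g x y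

/-- `(g, F)` is a solution of the Einstein--Maxwell equations:
`dF = 0`, `d(⋆F) = 0`, and `Ric₀ = −[F∘F]₀`. -/
def IsEMSolution (br : V4 → V4 → V4) (g F : V4 → V4 → ℝ) : Prop :=
  IsClosedForm br F ∧ IsCoclosed br g F ∧ ∀ x y, ricci0 br g x y = - FF0 g F x y

/-- Nijenhuis tensor `N_J(x,y) = [Jx,Jy] − J[Jx,y] − J[x,Jy] − [x,y]`. -/
def nijenhuis (br : V4 → V4 → V4) (J : V4 →ₗ[ℝ] V4) (x y : V4) : V4 :=
  br (J x) (J y) - J (br (J x) y) - J (br x (J y)) - br x y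

/-- The Lie algebra `𝒜₄,₉^{-1/2}`:
`[e₂,e₃] = e₁`, `[e₁,e₄] = (1/2)e₁`, `[e₂,e₄] = e₂`, `[e₃,e₄] = −(1/2)e₃`. -/
def brA49h : V4 → V4 → V4 := fun x y =>
  ((x 1 * y 2 - x 2 * y 1) + (1 / 2) * (x 0 * y 3 - x 3 * y 0)) • ee 0
    + (x 1 * y 3 - x 3 * y 1) • ee 1
    + (-(1 / 2) * (x 2 * y 3 - x 3 * y 2)) • ee 2

/-- The Euclidean inner product on `ℝ⁴`. -/
def euclid (x y : V4) : ℝ := x 0 * y 0 + x 1 * y 1 + x 2 * y 2 + x 3 * y 3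

/-- The 2-form `a e¹∧e³ + b e²∧e⁴`. -/
def form1324 (a b : ℝ) (x y : V4) : ℝ :=
  a * (x 0 * y 2 - x 2 * y 0) + b * (x 1 * y 3 - x 3 * y 1)

lemma isInnerProduct_euclid : IsInnerProduct euclid where
  symm x y := by simp only [euclid]; ring
  add_left x y z := by simp only [euclid, Pi.add_apply]; ring
  smul_left a x y := by simp only [euclid, Pi.smul_apply, smul_eq_mul]; ring
  pos x hx := by
    obtain ⟨i, hi⟩ := Function.ne_iff.mp hx
    have h_pos := mul_self_pos.mpr hi
    simp only [euclid]
    fin_cases i <;> simp only [Fin.zero_eta, Fin.mk_one, Fin.reduceFinMk] at h_pos <;>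
      nlinarith [mul_self_nonneg (x 0), mul_self_nonneg (x 1), mul_self_nonneg (x 2),
        mul_self_nonneg (x 3)]

lemma isAltForm_form1324 (a b : ℝ) : IsAltForm (form1324 a b) where
  skew x y := by simp only [form1324]; ring
  add_left x y z := by simp only [form1324, Pi.add_apply]; ring
  smul_left c x y := by simp only [form1324, Pi.smul_apply, smul_eq_mul]; ring

lemma ee_apply (i j : Fin 4) : ee i j = if j = i then 1 else 0 := by
  simp [ee, Pi.single_apply]

lemma gram_euclid : gram euclid = 1 := by
  ext i j
  fin_cases i <;> fin_cases j <;> simp [gram, euclid, ee_apply]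

lemma ginv_euclid : ginv euclid = 1 := by
  rw [ginv, gram_euclid, inv_one]

lemma IsAltForm.self_eq_zero {α : V4 → V4 → ℝ} (h : IsAltForm α) (x : V4) : α x x = 0 := by
  linarith [h.skew x x]

lemma eq_sum_ee (x : V4) : x = x 0 • ee 0 + x 1 • ee 1 + x 2 • ee 2 + x 3 • ee 3 := by
  ext i
  fin_cases i <;> simp [ee_apply]

/-- An alternating form in coordinates. -/
lemma IsAltForm.apply_eq {α : V4 → V4 → ℝ} (h : IsAltForm α) (x y : V4) :
    α x y = α (ee 0) (ee 1) * (x 0 * y 1 - x 1 * y 0) + α (ee 0) (ee 2) * (x 0 * y 2 - x 2 * y 0)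
      + α (ee 0) (ee 3) * (x 0 * y 3 - x 3 * y 0) + α (ee 1) (ee 2) * (x 1 * y 2 - x 2 * y 1)
      + α (ee 1) (ee 3) * (x 1 * y 3 - x 3 * y 1)
      + α (ee 2) (ee 3) * (x 2 * y 3 - x 3 * y 2) := by
  have expand (i : Fin 4) : α (ee i) y = y 0 * α (ee i) (ee 0) + y 1 * α (ee i) (ee 1)
      + y 2 * α (ee i) (ee 2) + y 3 * α (ee i) (ee 3) := by
    rw [h.skew]
    conv_lhs => rw [eq_sum_ee y]
    simp only [h.add_left, h.smul_left]
    rw [h.skew (ee i) (ee 0), h.skew (ee i) (ee 1), h.skew (ee i) (ee 2), h.skew (ee i) (ee 3)]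
    ring
  conv_lhs => rw [eq_sum_ee x]
  simp only [h.add_left, h.smul_left, expand, h.self_eq_zero]
  rw [h.skew (ee 1) (ee 0), h.skew (ee 2) (ee 0), h.skew (ee 3) (ee 0), h.skew (ee 2) (ee 1),
    h.skew (ee 3) (ee 1), h.skew (ee 3) (ee 2)]
  ring

lemma formInner_euclid (α β : V4 → V4 → ℝ) :
    formInner euclid α β = (1 / 2) * ∑ i, ∑ j, α (ee i) (ee j) * β (ee i) (ee j) := by
  simp [formInner, ginv_euclid, Matrix.one_apply]

lemma isHodgeStar_form1324 (a b : ℝ) :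
    IsHodgeStar euclid (form1324 a b) (form1324 (-b) (-a)) := by
  refine ⟨isAltForm_form1324 _ _, fun α hα x y z w => ?_⟩
  have h_inner : formInner euclid α (form1324 a b)
      = a * α (ee 0) (ee 2) + b * α (ee 1) (ee 3) := by
    rw [formInner_euclid]
    simp [Fin.sum_univ_four, form1324, ee_apply]
    rw [hα.skew (ee 2) (ee 0), hα.skew (ee 3) (ee 1)]
    ring
  rw [h_inner, vol, gram_euclid, Matrix.det_one, Real.sqrt_one]
  simp only [wedge22]
  rw [hα.apply_eq x y, hα.apply_eq x z, hα.apply_eq x w, hα.apply_eq z w, hα.apply_eq y w,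
    hα.apply_eq y z]
  simp [Matrix.det_succ_row_zero, Fin.sum_univ_succ, Fin.succAbove, form1324]
  ring

lemma brA49h_eq (x y : V4) : brA49h x y =
    ![(x 1 * y 2 - x 2 * y 1) + (1 / 2) * (x 0 * y 3 - x 3 * y 0), x 1 * y 3 - x 3 * y 1,
      -(1 / 2) * (x 2 * y 3 - x 3 * y 2), 0] := by
  ext i
  fin_cases i <;> simp [brA49h, ee_apply]

lemma isClosedForm_form1324 (a b : ℝ) : IsClosedForm brA49h (form1324 a b) := by
  intro x y z
  simp [cdiff, form1324, brA49h_eq]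
  ring

lemma LC_brA49h_euclid (x y : V4) : LC brA49h euclid x y =
    (1 / 2 : ℝ) • ![x 0 * y 3 + x 1 * y 2 - x 2 * y 1, x 0 * y 2 + 2 * (x 1 * y 3) + x 2 * y 0,
      -(x 0 * y 1) - x 1 * y 0 - x 2 * y 3, -(x 0 * y 0) - 2 * (x 1 * y 1) + x 2 * y 2] := by
  ext i
  fin_cases i <;>
    simp [LC, ginv_euclid, Matrix.one_apply, koszul, euclid, brA49h_eq, ee_apply] <;> ring

lemma ricci_brA49h_euclid (x y : V4) :
    ricci brA49h euclid x y = -(3 / 2) * (x 1 * y 1 + x 3 * y 3) := by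
  simp [ricci, curv, LC_brA49h_euclid, brA49h_eq, Fin.sum_univ_four, ee_apply]
  ring

lemma scal_brA49h_euclid : scal brA49h euclid = -3 := by
  simp [scal, ginv_euclid, Matrix.one_apply, ricci_brA49h_euclid, Fin.sum_univ_four, ee_apply]

lemma ricci0_brA49h_euclid (x y : V4) : ricci0 brA49h euclid x y =
    (3 / 4) * (x 0 * y 0 - x 1 * y 1 + x 2 * y 2 - x 3 * y 3) := by
  rw [ricci0, ricci_brA49h_euclid, scal_brA49h_euclid, euclid]
  ring

lemma fhat_euclid_form1324 (a b : ℝ) (x : V4) :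
    fhat euclid (form1324 a b) x = ![-(a * x 2), -(b * x 3), a * x 0, b * x 1] := by
  ext i
  fin_cases i <;> simp [fhat, ginv_euclid, Matrix.one_apply, form1324, ee_apply]

lemma FF0_euclid_form1324 (a b : ℝ) (x y : V4) : FF0 euclid (form1324 a b) x y =
    -((a ^ 2 - b ^ 2) / 2) * (x 0 * y 0 - x 1 * y 1 + x 2 * y 2 - x 3 * y 3) := by
  simp [FF0, fhat_euclid_form1324, Fin.sum_univ_four, euclid, ee_apply]
  ring

lemma not_isEinstein_brA49h_euclid : ¬ IsEinstein brA49h euclid := by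
  intro h_einstein
  have h00 := h_einstein (ee 0) (ee 0)
  simp [ricci0_brA49h_euclid, ee_apply] at h00

/-- on `𝒜₄,₉^{-1/2}`, if `a₁₃² − a₂₄² = 3/2` then the Euclidean metric with
`F = a₁₃ e¹∧e³ + a₂₄ e²∧e⁴` is a non-Einstein solution of the Einstein--Maxwell equations. -/
theorem stmt4 (a13 a24 : ℝ) (h : a13 ^ 2 - a24 ^ 2 = 3 / 2)
    (g F : V4 → V4 → ℝ)
    (hg : g = fun x y => x 0 * y 0 + x 1 * y 1 + x 2 * y 2 + x 3 * y 3)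
    (hF : F = fun x y => a13 * (x 0 * y 2 - x 2 * y 0) + a24 * (x 1 * y 3 - x 3 * y 1)) :
    IsInnerProduct g ∧ IsAltForm F ∧ IsEMSolution brA49h g F ∧ ¬ IsEinstein brA49h g := by
  obtain rfl : g = euclid := hg
  obtain rfl : F = form1324 a13 a24 := hF
  refine ⟨isInnerProduct_euclid, isAltForm_form1324 _ _, ⟨isClosedForm_form1324 _ _,
    ⟨_, isHodgeStar_form1324 _ _, isClosedForm_form1324 _ _⟩, fun x y => ?_⟩,
    not_isEinstein_brA49h_euclid⟩
  rw [ricci0_brA49h_euclid, FF0_euclid_form1324, h]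
  ring
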